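/- Under Assumptions (A1)–(A6), the random variables D_N := ∫_{√N(Θ−T_N)} |π_N(t|·) − φ_{0,(V*)⁻¹}(t)| dt converge to 0 in P-probability as N → ∞, where φ_{0,(V*)⁻¹} is the density of the d-variate normal distribution with mean 0 and covariance matrix (V*)⁻¹. (Misspecified Bernstein–von Mises theorem, total-variation form.) -/

import Mathlib

open MeasureTheory Filter Matrix

attribute [local instance] Matrix.frobeniusNormedAddCommGroup

section QuadraticForms

variable {d : ℕ}

lemma abs_dotProduct_mulVec_le {A : Matrix (Fin d) (Fin d) ℝ} {K : ℝ}
    (hA : ∀ i j, |A i j| ≤ K) (u : Fin d → ℝ) :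
    |u ⬝ᵥ A *ᵥ u| ≤ d * K * (u ⬝ᵥ u) := by
  have hterm : ∀ i j, |u i * (A i j * u j)| ≤ K * ((u i * u i + u j * u j) / 2) := by
    intro i j
    have hK : 0 ≤ K := (abs_nonneg _).trans (hA i j)
    have huv : |u i| * |u j| ≤ (u i * u i + u j * u j) / 2 := by
      nlinarith [sq_nonneg (|u i| - |u j|), abs_mul_abs_self (u i), abs_mul_abs_self (u j)]
    calc |u i * (A i j * u j)| = |A i j| * (|u i| * |u j|) := by
          rw [abs_mul, abs_mul]; ring
      _ ≤ K * ((u i * u i + u j * u j) / 2) := by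
          gcongr
          exact hA i j
  calc |u ⬝ᵥ A *ᵥ u| = |∑ i, ∑ j, u i * (A i j * u j)| := by
        simp only [dotProduct, mulVec, Finset.mul_sum]
    _ ≤ ∑ i, ∑ j, K * ((u i * u i + u j * u j) / 2) :=
        (Finset.abs_sum_le_sum_abs _ _).trans <| Finset.sum_le_sum fun i _ =>
          (Finset.abs_sum_le_sum_abs _ _).trans <| Finset.sum_le_sum fun j _ => hterm i j
    _ = d * K * (u ⬝ᵥ u) := by
        simp only [← Finset.mul_sum, ← Finset.sum_div, Finset.sum_add_distrib, Finset.sum_const,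
          Finset.card_univ, Fintype.card_fin, dotProduct, nsmul_eq_mul]
        ring_nf
        rw [← Finset.sum_mul]
        ring

lemma abs_apply_le_frobenius_norm (A : Matrix (Fin d) (Fin d) ℝ) (i j : Fin d) :
    |A i j| ≤ ‖A‖ := by
  have h : ‖A i j‖ ^ (2 : ℝ) ≤ ∑ i, ∑ j, ‖A i j‖ ^ (2 : ℝ) :=
    (Finset.single_le_sum (f := fun j => ‖A i j‖ ^ (2 : ℝ)) (fun _ _ => by positivity)
      (Finset.mem_univ j)).trans <|
    Finset.single_le_sum (f := fun i => ∑ j, ‖A i j‖ ^ (2 : ℝ)) (fun _ _ => by positivity)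
      (Finset.mem_univ i)
  rw [Matrix.frobenius_norm_def]
  calc |A i j| = (‖A i j‖ ^ (2 : ℝ)) ^ (1 / 2 : ℝ) := by
        rw [← Real.rpow_mul (norm_nonneg _)]; simp
    _ ≤ _ := by gcongr

lemma dotProduct_self_nonneg_real (u : Fin d → ℝ) : 0 ≤ u ⬝ᵥ u := by
  simpa using dotProduct_star_self_nonneg u

lemma dotProduct_self_add_le (u v : Fin d → ℝ) :
    (u + v) ⬝ᵥ (u + v) ≤ 2 * (u ⬝ᵥ u) + 2 * (v ⬝ᵥ v) := by
  have h := dotProduct_self_nonneg_real (u - v)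
  simp only [sub_dotProduct, dotProduct_sub, add_dotProduct, dotProduct_add] at h ⊢
  linarith

open scoped MatrixOrder in
lemma Matrix.PosDef.exists_isUnit_transpose_mul_self {V : Matrix (Fin d) (Fin d) ℝ}
    (hV : V.PosDef) : ∃ B : Matrix (Fin d) (Fin d) ℝ, IsUnit B.det ∧ V = Bᵀ * B := by
  obtain ⟨B, hB⟩ := CStarAlgebra.nonneg_iff_eq_star_mul_self.mp hV.posSemidef.nonneg
  have hB' : V = Bᵀ * B := by simpa [star_eq_conjTranspose] using hB
  refine ⟨B, ?_, hB'⟩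
  have h := hV.det_pos
  rw [hB', det_mul, det_transpose] at h
  exact isUnit_iff_ne_zero.mpr fun h0 => by simp [h0] at h

lemma dotProduct_transpose_mul_self_mulVec (B : Matrix (Fin d) (Fin d) ℝ) (u : Fin d → ℝ) :
    u ⬝ᵥ (Bᵀ * B) *ᵥ u = (B *ᵥ u) ⬝ᵥ (B *ᵥ u) := by
  rw [← mulVec_mulVec, dotProduct_mulVec, vecMul_transpose]

lemma Matrix.PosDef.exists_coercive {V : Matrix (Fin d) (Fin d) ℝ} (hV : V.PosDef) :
    ∃ c > 0, ∀ u : Fin d → ℝ, c * (u ⬝ᵥ u) ≤ u ⬝ᵥ V *ᵥ u := by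
  obtain ⟨B, hB, rfl⟩ := hV.exists_isUnit_transpose_mul_self
  set K : ℝ := d * ‖(B⁻¹)ᵀ * B⁻¹‖ with hK
  have hK0 : 0 ≤ K := by positivity
  refine ⟨(K + 1)⁻¹, by positivity, fun u => ?_⟩
  rw [dotProduct_transpose_mul_self_mulVec, inv_mul_le_iff₀ (by positivity)]
  have h := abs_dotProduct_mulVec_le (abs_apply_le_frobenius_norm ((B⁻¹)ᵀ * B⁻¹)) (B *ᵥ u)
  rw [dotProduct_transpose_mul_self_mulVec, mulVec_mulVec, nonsing_inv_mul _ hB, one_mulVec] at h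
  have := dotProduct_self_nonneg_real (B *ᵥ u)
  linarith [le_abs_self (u ⬝ᵥ u)]

end QuadraticForms

section GaussianIntegral

variable {d : ℕ}

lemma exp_mul_dotProduct_self (c : ℝ) (u : Fin d → ℝ) :
    Real.exp (-c * (u ⬝ᵥ u)) = ∏ i, Real.exp (-c * u i ^ 2) := by
  rw [← Real.exp_sum, dotProduct, Finset.mul_sum]
  simp only [sq]

lemma integrable_exp_neg_mul_dotProduct_self {c : ℝ} (hc : 0 < c) :
    Integrable fun u : Fin d → ℝ => Real.exp (-c * (u ⬝ᵥ u)) := by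
  simp only [exp_mul_dotProduct_self]
  exact Integrable.fintype_prod (f := fun _ x => Real.exp (-c * x ^ 2))
    fun _ => integrable_exp_neg_mul_sq hc

lemma Matrix.PosDef.integrable_exp {V : Matrix (Fin d) (Fin d) ℝ} (hV : V.PosDef) :
    Integrable fun u : Fin d → ℝ => Real.exp (-(1 / 2) * (u ⬝ᵥ V *ᵥ u)) := by
  obtain ⟨c, hc, h⟩ := hV.exists_coercive
  refine (integrable_exp_neg_mul_dotProduct_self (half_pos hc)).mono' ?_ ?_
  · exact (by fun_prop : Continuous _).aestronglyMeasurable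
  · refine .of_forall fun u => ?_
    rw [Real.norm_eq_abs, Real.abs_exp, Real.exp_le_exp]
    linarith [h u]

lemma Matrix.PosDef.integral_exp {V : Matrix (Fin d) (Fin d) ℝ} (hV : V.PosDef) :
    ∫ u : Fin d → ℝ, Real.exp (-(1 / 2) * (u ⬝ᵥ V *ᵥ u)) =
      ((2 * Real.pi) ^ (-(d : ℝ) / 2) * V.det ^ ((1 : ℝ) / 2))⁻¹ := by
  obtain ⟨B, hB, rfl⟩ := hV.exists_isUnit_transpose_mul_self
  simp only [dotProduct_transpose_mul_self_mulVec]
  have hmap := Real.map_matrix_volume_pi_eq_smul_volume_pi hB.ne_zero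
  have hg : Continuous fun w : Fin d → ℝ => Real.exp (-(1 / 2) * (w ⬝ᵥ w)) := by fun_prop
  have h1 : ∫ u : Fin d → ℝ, Real.exp (-(1 / 2) * ((B *ᵥ u) ⬝ᵥ (B *ᵥ u))) =
      |B.det⁻¹| * ∫ w : Fin d → ℝ, Real.exp (-(1 / 2) * (w ⬝ᵥ w)) := by
    have h := integral_map (μ := volume) (φ := toLin' B)
      (LinearMap.continuous_of_finiteDimensional (toLin' B)).aemeasurable
      hg.aestronglyMeasurable
    rw [hmap, integral_smul_measure] at h
    simpa using h.symm
  have h2 : ∫ w : Fin d → ℝ, Real.exp (-(1 / 2) * (w ⬝ᵥ w)) = √(2 * Real.pi) ^ d := by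
    simp only [exp_mul_dotProduct_self]
    rw [integral_fintype_prod_volume_eq_pow (fun x : ℝ => Real.exp (-(1 / 2) * x ^ 2)),
      integral_gaussian, Fintype.card_fin]
    congr 2
    ring
  have h3 : (Bᵀ * B).det ^ ((1 : ℝ) / 2) = |B.det| := by
    rw [det_mul, det_transpose, ← Real.sqrt_eq_rpow, Real.sqrt_mul_self_eq_abs]
  have h4 : (2 * Real.pi) ^ (-(d : ℝ) / 2) = (√(2 * Real.pi) ^ d)⁻¹ := by
    rw [Real.sqrt_eq_rpow, ← Real.rpow_natCast, ← Real.rpow_mul (by positivity),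
      ← Real.rpow_neg (by positivity)]
    congr 1
    ring
  rw [h1, h2, h3, h4, mul_inv, inv_inv, abs_inv, mul_comm]

end GaussianIntegral

section Normalization

variable {X α : Type*} [MeasurableSpace α] {μ : Measure α} {l : Filter X}

lemma tendsto_integral_abs_normalize_sub {f : X → α → ℝ} {q : α → ℝ} (hq : Integrable q μ)
    (hq0 : ∫ a, q a ∂μ ≠ 0) (hf : ∀ᶠ x in l, Integrable (f x) μ)
    (h : Tendsto (fun x => ∫ a, |f x a - q a| ∂μ) l (nhds 0)) :
    Tendsto (fun x => ∫ a, |f x a / (∫ b, f x b ∂μ) - q a / (∫ b, q b ∂μ)| ∂μ) l (nhds 0) := by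
  have hZ : Tendsto (fun x => ∫ b, f x b ∂μ) l (nhds (∫ b, q b ∂μ)) := by
    rw [tendsto_iff_norm_sub_tendsto_zero]
    refine squeeze_zero' (.of_forall fun _ => norm_nonneg _) ?_ h
    filter_upwards [hf] with x hx
    rw [← integral_sub hx hq]
    exact norm_integral_le_integral_norm _
  have hZinv := hZ.inv₀ hq0
  have hbound : Tendsto (fun x => (∫ a, |f x a - q a| ∂μ) * |(∫ b, f x b ∂μ)⁻¹| +
      (∫ a, |q a| ∂μ) * |(∫ b, f x b ∂μ)⁻¹ - (∫ b, q b ∂μ)⁻¹|) l (nhds 0) := by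
    have h2 := (hZinv.sub_const (∫ b, q b ∂μ)⁻¹).abs.const_mul (∫ a, |q a| ∂μ)
    simpa using (h.mul hZinv.abs).add h2
  refine squeeze_zero' (.of_forall fun _ => integral_nonneg fun _ => abs_nonneg _) ?_ hbound
  filter_upwards [hf] with x hx
  rw [← integral_mul_const, ← integral_mul_const]
  have h1 := (hx.sub hq).abs.mul_const |(∫ b, f x b ∂μ)⁻¹|
  have h2 := hq.abs.mul_const |(∫ b, f x b ∂μ)⁻¹ - (∫ b, q b ∂μ)⁻¹|
  refine (integral_mono ((hx.div_const _).sub (hq.div_const _)).abs (h1.add h2)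
    fun a => ?_).trans_eq (integral_add h1 h2)
  simp only [Pi.sub_apply, Pi.add_apply, ← abs_mul]
  refine le_trans (le_of_eq ?_) (abs_add_le _ _)
  congr 1
  ring

end Normalization

section Laplace

variable {d : ℕ}

lemma integral_comp_add_inv_smul (f : (Fin d → ℝ) → ℝ) (a : Fin d → ℝ) (r : ℝ) :
    ∫ t, f (a + r⁻¹ • t) = |r ^ d| * ∫ θ, f θ := by
  rw [Measure.integral_comp_inv_smul volume (fun t => f (a + t)) r, integral_add_left_eq_self]
  simp

lemma MeasureTheory.Integrable.comp_add_inv_smul {f : (Fin d → ℝ) → ℝ} (hf : Integrable f)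
    (a : Fin d → ℝ) {r : ℝ} (hr : r ≠ 0) : Integrable fun t => f (a + r⁻¹ • t) :=
  (hf.comp_add_left a).comp_smul (inv_ne_zero hr)

variable {X : Type*} {l : Filter X} {Θ : Set (Fin d → ℝ)} {θ₀ : Fin d → ℝ}
  {V : Matrix (Fin d) (Fin d) ℝ} {π : (Fin d → ℝ) → ℝ} {r : X → ℝ} {T : X → Fin d → ℝ}
  {h : X → (Fin d → ℝ) → ℝ}

lemma tendsto_add_inv_smul (hr : Tendsto r l atTop) (hT : Tendsto T l (nhds θ₀))
    (t : Fin d → ℝ) : Tendsto (fun x => T x + (r x)⁻¹ • t) l (nhds θ₀) := by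
  simpa using hT.add ((tendsto_inv_atTop_zero.comp hr).smul_const t)

/-- Away from `θ₀` the rescaled unnormalized posterior has asymptotically no mass. -/
lemma tendsto_integral_indicator_compl_closedBall
    (hΘ : MeasurableSet Θ) (hπnn : ∀ θ, 0 ≤ π θ) (hπint : Integrable π)
    (hr : Tendsto r l atTop)
    (hfar : ∀ δ > 0, ∃ ε > 0, ∀ᶠ x in l, ∀ θ ∈ Θ, δ ≤ ‖θ - θ₀‖ → h x θ ≤ -(ε * r x ^ 2))
    (hint : ∀ᶠ x in l, IntegrableOn (fun θ => π θ * Real.exp (h x θ)) Θ) {δ : ℝ} (hδ : 0 < δ) :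
    Tendsto (fun x => ∫ t, (Metric.closedBall θ₀ δ)ᶜ.indicator
      (Θ.indicator fun θ => π θ * Real.exp (h x θ)) (T x + (r x)⁻¹ • t)) l (nhds 0) := by
  obtain ⟨ε, hε, hfar⟩ := hfar δ hδ
  have hlim : Tendsto (fun x => (r x ^ 2) ^ (d / 2 : ℝ) * Real.exp (-ε * r x ^ 2) * ∫ θ, π θ)
      l (nhds 0) := by
    have h1 := (tendsto_rpow_mul_exp_neg_mul_atTop_nhds_zero (d / 2 : ℝ) ε hε).comp
      ((tendsto_pow_atTop two_ne_zero).comp hr)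
    simpa using h1.mul_const (∫ θ, π θ)
  have hnn : ∀ x θ, 0 ≤ (Metric.closedBall θ₀ δ)ᶜ.indicator
      (Θ.indicator fun θ => π θ * Real.exp (h x θ)) θ := fun x θ =>
    Set.indicator_nonneg (fun _ _ => Set.indicator_nonneg
      (fun θ _ => mul_nonneg (hπnn θ) (Real.exp_pos _).le) _) _
  refine squeeze_zero' (.of_forall fun x => integral_nonneg fun t => hnn x _) ?_ hlim
  filter_upwards [hfar, hint, hr.eventually_ge_atTop 0] with x hx hintx hrx
  have hpow : (r x ^ 2) ^ (d / 2 : ℝ) = |r x ^ d| := by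
    rw [abs_of_nonneg (by positivity), ← Real.rpow_natCast (r x) 2, ← Real.rpow_mul hrx,
      ← Real.rpow_natCast (r x) d]
    congr 1
    push_cast
    ring
  rw [integral_comp_add_inv_smul, hpow, mul_assoc, ← integral_const_mul (Real.exp _) π]
  refine mul_le_mul_of_nonneg_left (integral_mono
    (((integrable_indicator_iff hΘ).mpr hintx).indicator
      Metric.isClosed_closedBall.measurableSet.compl) (hπint.const_mul _) fun θ => ?_)
    (abs_nonneg _)
  have hRHS : 0 ≤ Real.exp (-ε * r x ^ 2) * π θ := mul_nonneg (Real.exp_pos _).le (hπnn θ)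
  by_cases hb : θ ∈ (Metric.closedBall θ₀ δ)ᶜ
  · by_cases hm : θ ∈ Θ
    · rw [Set.indicator_of_mem hb, Set.indicator_of_mem hm, mul_comm]
      rw [Set.mem_compl_iff, Metric.mem_closedBall, not_le, dist_eq_norm] at hb
      refine mul_le_mul_of_nonneg_right (Real.exp_le_exp.mpr ?_) (hπnn θ)
      rw [neg_mul]
      exact hx θ hm hb.le
    · rwa [Set.indicator_of_mem hb, Set.indicator_of_notMem hm]
  · rwa [Set.indicator_of_notMem hb]

/-- Near `θ₀` the rescaled unnormalized posterior converges to a Gaussian in `L¹`. -/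
lemma tendsto_integral_abs_indicator_closedBall_sub [l.IsCountablyGenerated]
    (hΘ : MeasurableSet Θ) (hθ₀ : θ₀ ∈ interior Θ) (hV : V.PosDef) (hπnn : ∀ θ, 0 ≤ π θ)
    (hπ : ContinuousAt π θ₀) (hr : Tendsto r l atTop) (hT : Tendsto T l (nhds θ₀))
    (hquad : ∀ ε > 0, ∃ δ > 0, ∀ᶠ x in l, ∀ t, T x + (r x)⁻¹ • t ∈ Θ →
      ‖T x + (r x)⁻¹ • t - θ₀‖ ≤ δ →
      |h x (T x + (r x)⁻¹ • t) + 1 / 2 * (t ⬝ᵥ V *ᵥ t)| ≤ ε * (1 + t ⬝ᵥ t))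
    (hint : ∀ᶠ x in l, IntegrableOn (fun θ => π θ * Real.exp (h x θ)) Θ) :
    ∃ δ > 0, Tendsto (fun x => ∫ t, |(Metric.closedBall θ₀ δ).indicator
      (Θ.indicator fun θ => π θ * Real.exp (h x θ)) (T x + (r x)⁻¹ • t) -
        π θ₀ * Real.exp (-(1 / 2) * (t ⬝ᵥ V *ᵥ t))|) l (nhds 0) := by
  obtain ⟨c, hc, hcoer⟩ := hV.exists_coercive
  obtain ⟨δ₁, hδ₁, hnear⟩ := hquad (c / 4) (by positivity)
  obtain ⟨δ₂, hδ₂, hπδ⟩ := Metric.continuousAt_iff.mp hπ 1 one_pos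
  obtain ⟨δ, hδ, hδδ₁, hδδ₂⟩ : ∃ δ > 0, δ ≤ δ₁ ∧ δ < δ₂ :=
    ⟨min δ₁ (δ₂ / 2), by positivity, min_le_left _ _, (min_le_right _ _).trans_lt (by linarith)⟩
  have hball : MeasurableSet (Metric.closedBall θ₀ δ) := Metric.isClosed_closedBall.measurableSet
  refine ⟨δ, hδ, ?_⟩
  rw [← integral_zero (Fin d → ℝ) ℝ (μ := volume)]
  refine tendsto_integral_filter_of_dominated_convergence
    (fun t => (π θ₀ + 1) * Real.exp (c / 4) * Real.exp (-(c / 4) * (t ⬝ᵥ t)) +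
      π θ₀ * Real.exp (-(1 / 2) * (t ⬝ᵥ V *ᵥ t))) ?_ ?_ ?_ ?_
  · filter_upwards [hint, hr.eventually_gt_atTop 0] with x hx hrx
    exact (((((integrable_indicator_iff hΘ).mpr hx).indicator hball).comp_add_inv_smul _
      hrx.ne').sub (hV.integrable_exp.const_mul _)).abs.aestronglyMeasurable
  · filter_upwards [hnear] with x hx
    refine .of_forall fun t => ?_
    rw [Real.norm_eq_abs, abs_abs]
    refine (abs_sub _ _).trans (add_le_add ?_ (le_of_eq ?_))
    · have hnn : 0 ≤ (π θ₀ + 1) * Real.exp (c / 4) * Real.exp (-(c / 4) * (t ⬝ᵥ t)) := by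
        have := hπnn θ₀
        positivity
      by_cases hb : T x + (r x)⁻¹ • t ∈ Metric.closedBall θ₀ δ
      · by_cases hm : T x + (r x)⁻¹ • t ∈ Θ
        · rw [Set.indicator_of_mem hb, Set.indicator_of_mem hm,
            abs_of_nonneg (mul_nonneg (hπnn _) (Real.exp_pos _).le), mul_assoc, ← Real.exp_add]
          rw [Metric.mem_closedBall] at hb
          have h1 := hπδ (hb.trans_lt hδδ₂)
          rw [Real.dist_eq] at h1
          have h2 := hx t hm ((dist_eq_norm _ θ₀ ▸ hb).trans hδδ₁)
          have h3 := hπnn θ₀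
          gcongr
          · linarith [(abs_lt.mp h1).2]
          · linarith [(abs_le.mp h2).2, hcoer t]
        · rwa [Set.indicator_of_mem hb, Set.indicator_of_notMem hm, abs_zero]
      · rwa [Set.indicator_of_notMem hb, abs_zero]
    · exact abs_of_nonneg (mul_nonneg (hπnn _) (Real.exp_pos _).le)
  · exact ((integrable_exp_neg_mul_dotProduct_self (by positivity)).const_mul _).add
      (hV.integrable_exp.const_mul _)
  · refine .of_forall fun t => ?_
    have hθ := tendsto_add_inv_smul hr hT t
    have hh : Tendsto (fun x => h x (T x + (r x)⁻¹ • t)) l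
        (nhds (-(1 / 2) * (t ⬝ᵥ V *ᵥ t))) := by
      rw [Metric.tendsto_nhds]
      intro ε hε
      have hQ := dotProduct_self_nonneg_real t
      obtain ⟨δ', hδ', hx⟩ := hquad (ε / 2 / (1 + t ⬝ᵥ t)) (by positivity)
      filter_upwards [hx, hθ.eventually (Metric.closedBall_mem_nhds θ₀ hδ'),
        hθ.eventually (mem_interior_iff_mem_nhds.mp hθ₀)] with x hx hxδ hxΘ
      have h1 := hx t hxΘ (by rwa [← dist_eq_norm, ← Metric.mem_closedBall])
      rw [div_mul_cancel₀ _ (by positivity)] at h1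
      rw [Real.dist_eq]
      refine lt_of_le_of_lt ?_ (half_lt_self hε)
      rwa [neg_mul, sub_neg_eq_add]
    have hlim := ((hπ.tendsto.comp hθ).mul ((Real.continuous_exp.tendsto _).comp hh)).sub_const
      (π θ₀ * Real.exp (-(1 / 2) * (t ⬝ᵥ V *ᵥ t)))
    rw [sub_self] at hlim
    have hlim' := hlim.abs
    rw [abs_zero] at hlim'
    refine hlim'.congr' ?_
    filter_upwards [hθ.eventually (Metric.closedBall_mem_nhds θ₀ hδ),
      hθ.eventually (mem_interior_iff_mem_nhds.mp hθ₀)] with x hxδ hxΘ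
    rw [Set.indicator_of_mem (show T x + (r x)⁻¹ • t ∈ Metric.closedBall θ₀ δ from hxδ),
      Set.indicator_of_mem (show T x + (r x)⁻¹ • t ∈ Θ from hxΘ)]
    rfl

/-- A Laplace-type approximation: if the local log-likelihood ratio `h` is asymptotically
quadratic near `θ₀` and negligible away from `θ₀`, the rescaled unnormalized posterior converges
to a multiple of a Gaussian in `L¹`. -/
lemma tendsto_integral_abs_indicator_sub_gaussian [l.IsCountablyGenerated]
    (hΘ : MeasurableSet Θ) (hθ₀ : θ₀ ∈ interior Θ) (hV : V.PosDef) (hπnn : ∀ θ, 0 ≤ π θ)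
    (hπint : Integrable π)
    (hπ : ContinuousAt π θ₀) (hr : Tendsto r l atTop) (hT : Tendsto T l (nhds θ₀))
    (hquad : ∀ ε > 0, ∃ δ > 0, ∀ᶠ x in l, ∀ t, T x + (r x)⁻¹ • t ∈ Θ →
      ‖T x + (r x)⁻¹ • t - θ₀‖ ≤ δ →
      |h x (T x + (r x)⁻¹ • t) + 1 / 2 * (t ⬝ᵥ V *ᵥ t)| ≤ ε * (1 + t ⬝ᵥ t))
    (hfar : ∀ δ > 0, ∃ ε > 0, ∀ᶠ x in l, ∀ θ ∈ Θ, δ ≤ ‖θ - θ₀‖ → h x θ ≤ -(ε * r x ^ 2))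
    (hint : ∀ᶠ x in l, IntegrableOn (fun θ => π θ * Real.exp (h x θ)) Θ) :
    Tendsto (fun x => ∫ t, |Θ.indicator (fun θ => π θ * Real.exp (h x θ)) (T x + (r x)⁻¹ • t) -
        π θ₀ * Real.exp (-(1 / 2) * (t ⬝ᵥ V *ᵥ t))|) l (nhds 0) := by
  obtain ⟨δ, hδ, hnear⟩ :=
    tendsto_integral_abs_indicator_closedBall_sub hΘ hθ₀ hV hπnn hπ hr hT hquad hint
  have hsum := hnear.add
    (tendsto_integral_indicator_compl_closedBall (T := T) hΘ hπnn hπint hr hfar hint hδ)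
  rw [add_zero] at hsum
  have hball : MeasurableSet (Metric.closedBall θ₀ δ) := Metric.isClosed_closedBall.measurableSet
  refine squeeze_zero' (.of_forall fun x => integral_nonneg fun t => abs_nonneg _) ?_ hsum
  filter_upwards [hint, hr.eventually_gt_atTop 0] with x hx hrx
  have hw := (integrable_indicator_iff hΘ).mpr hx
  have hq := hV.integrable_exp.const_mul (π θ₀)
  have h1 := (((hw.indicator hball).comp_add_inv_smul (T x) hrx.ne').sub hq).abs
  have h2 := (hw.indicator hball.compl).comp_add_inv_smul (T x) hrx.ne'
  refine (integral_mono ((hw.comp_add_inv_smul (T x) hrx.ne').sub hq).abs (h1.add h2)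
    fun t => ?_).trans_eq (integral_add h1 h2)
  dsimp only [Pi.add_apply, Pi.sub_apply]
  have hnn : 0 ≤ (Metric.closedBall θ₀ δ)ᶜ.indicator
      (Θ.indicator fun θ => π θ * Real.exp (h x θ)) (T x + (r x)⁻¹ • t) :=
    Set.indicator_nonneg (fun _ _ => Set.indicator_nonneg
      (fun θ _ => mul_nonneg (hπnn θ) (Real.exp_pos _).le) _) _
  rw [← congrFun (Set.indicator_self_add_compl (Metric.closedBall θ₀ δ)
    (Θ.indicator fun θ => π θ * Real.exp (h x θ))) (T x + (r x)⁻¹ • t), Pi.add_apply,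
    add_sub_right_comm]
  exact (abs_add_le _ _).trans_eq (by rw [abs_of_nonneg hnn])

end Laplace

section DeterministicLimit

lemma setIntegral_abs_normalize_sub_le {α : Type*} [MeasurableSpace α] {μ : Measure α} {A : Set α}
    (hA : MeasurableSet A) {u p : α → ℝ} {κ : ℝ} (hκ : κ ≠ 0)
    (hu : Integrable (A.indicator fun a => κ * u a) μ) (hp : Integrable p μ) :
    ∫ a in A, |u a / (∫ b in A, u b ∂μ) - p a| ∂μ ≤
      ∫ a, |A.indicator (fun a => κ * u a) a / (∫ b, A.indicator (fun a => κ * u a) b ∂μ) - p a|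
        ∂μ := by
  have hg := ((hu.div_const (∫ b, A.indicator (fun a => κ * u a) b ∂μ)).sub hp).abs
  refine le_trans (le_of_eq ?_)
    (setIntegral_le_integral (s := A) hg (.of_forall fun _ => abs_nonneg _))
  refine setIntegral_congr_fun hA fun a ha => ?_
  rw [integral_indicator hA, Set.indicator_of_mem ha, integral_const_mul,
    mul_div_mul_left _ _ hκ]

variable {d : ℕ}

lemma norm_le_one_add_dotProduct_self (u : Fin d → ℝ) : ‖u‖ ≤ 1 + u ⬝ᵥ u := by
  have hu := dotProduct_self_nonneg_real u
  refine (pi_norm_le_iff_of_nonneg (by positivity)).mpr fun i => ?_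
  have h : u i * u i ≤ u ⬝ᵥ u :=
    Finset.single_le_sum (f := fun i => u i * u i) (fun i _ => mul_self_nonneg _)
      (Finset.mem_univ i)
  rw [Real.norm_eq_abs]
  nlinarith [sq_nonneg (|u i| - 1), abs_mul_abs_self (u i)]

lemma dotProduct_self_le_of_norm_le {u : Fin d → ℝ} {M : ℝ} (hu : ‖u‖ ≤ M) :
    u ⬝ᵥ u ≤ d * M ^ 2 := by
  calc u ⬝ᵥ u = ∑ i, u i * u i := rfl
    _ ≤ ∑ _i : Fin d, M ^ 2 := Finset.sum_le_sum fun i _ => by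
        rw [← sq]
        exact sq_le_sq' (neg_le_of_abs_le ((norm_le_pi_norm u i).trans hu))
          ((le_abs_self _).trans ((norm_le_pi_norm u i).trans hu))
    _ = d * M ^ 2 := by simp

variable {X : Type*} {l : Filter X} {V : X → Matrix (Fin d) (Fin d) ℝ}
  {V₀ : Matrix (Fin d) (Fin d) ℝ}

lemma eventually_abs_dotProduct_mulVec_sub_le (hV : Tendsto V l (nhds V₀)) {ε : ℝ} (hε : 0 < ε) :
    ∀ᶠ x in l, ∀ u : Fin d → ℝ, |u ⬝ᵥ V x *ᵥ u - u ⬝ᵥ V₀ *ᵥ u| ≤ ε * (u ⬝ᵥ u) := by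
  have hentry : ∀ᶠ x in l, ∀ i j, |(V x - V₀) i j| ≤ ε / (d + 1) := by
    refine eventually_all.mpr fun i => eventually_all.mpr fun j => ?_
    have h := ((continuous_apply_apply i j).tendsto V₀).comp hV
    filter_upwards [Metric.tendsto_nhds.mp h (ε / (d + 1)) (by positivity)] with x hx
    exact hx.le
  filter_upwards [hentry] with x hx u
  rw [← dotProduct_sub, ← sub_mulVec]
  refine (abs_dotProduct_mulVec_le hx u).trans
    (mul_le_mul_of_nonneg_right ?_ (dotProduct_self_nonneg_real u))
  rw [mul_div_assoc', div_le_iff₀ (by positivity)]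
  nlinarith

lemma eventually_dotProduct_self_inv_mulVec_le (hV : Tendsto V l (nhds V₀)) (hV₀ : V₀.PosDef)
    (hVunit : ∀ x, IsUnit (V x).det) {g : X → Fin d → ℝ} {M : ℝ} (hg : ∀ᶠ x in l, ‖g x‖ ≤ M) :
    ∃ B ≥ 0, ∀ᶠ x in l, ((V x)⁻¹ *ᵥ g x) ⬝ᵥ ((V x)⁻¹ *ᵥ g x) ≤ B ∧
      0 ≤ ((V x)⁻¹ *ᵥ g x) ⬝ᵥ V x *ᵥ ((V x)⁻¹ *ᵥ g x) := by
  obtain ⟨c, hc, hcoer⟩ := hV₀.exists_coercive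
  refine ⟨4 / c ^ 2 * (d * M ^ 2), by positivity, ?_⟩
  filter_upwards [hg, eventually_abs_dotProduct_mulVec_sub_le hV (half_pos hc)] with x hgx hVx
  have hVs : V x *ᵥ ((V x)⁻¹ *ᵥ g x) = g x := by
    rw [mulVec_mulVec, mul_nonsing_inv _ (hVunit x), one_mulVec]
  set s := (V x)⁻¹ *ᵥ g x
  have h1 := (abs_le.mp (hVx s)).1
  have h2 := hcoer s
  have hQ := dotProduct_self_nonneg_real s
  refine ⟨?_, by nlinarith⟩
  rw [hVs] at h1
  have h3 := dotProduct_self_nonneg_real (s - (2 / c) • g x)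
  simp only [sub_dotProduct, dotProduct_sub, smul_dotProduct, dotProduct_smul, smul_eq_mul,
    dotProduct_comm (g x) s] at h3
  have h4 := dotProduct_self_le_of_norm_le hgx
  have h5 : 4 / c * (s ⬝ᵥ g x) ≤ s ⬝ᵥ s + 4 / c ^ 2 * (g x ⬝ᵥ g x) := by
    have : 4 / c ^ 2 = 2 / c * (2 / c) := by ring
    rw [this]
    linarith [show 4 / c * (s ⬝ᵥ g x) = 2 * (2 / c * (s ⬝ᵥ g x)) by ring]
  have h6 : 2 * (s ⬝ᵥ s) ≤ 4 / c * (s ⬝ᵥ g x) := by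
    rw [div_mul_eq_mul_div, le_div_iff₀ hc]
    linarith
  have h7 : 4 / c ^ 2 * (g x ⬝ᵥ g x) ≤ 4 / c ^ 2 * (d * M ^ 2) := by gcongr
  linarith

/-- Completing the square in a second-order expansion around `θs`, recentred at
`θs + r⁻¹ • s` with `V s = r⁻¹ G`. -/
lemma expansion_recentred {W R : Matrix (Fin d) (Fin d) ℝ} (hW : W.IsSymm) {r : ℝ} (hr : r ≠ 0)
    {s G : Fin d → ℝ} (hs : W *ᵥ s = r⁻¹ • G) (t : Fin d → ℝ) :
    G ⬝ᵥ (r⁻¹ • (t + s)) - 1 / 2 * ((r⁻¹ • (t + s)) ⬝ᵥ (r ^ 2 • W + R) *ᵥ (r⁻¹ • (t + s))) =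
      1 / 2 * (s ⬝ᵥ W *ᵥ s) - 1 / 2 * (t ⬝ᵥ W *ᵥ t) -
        1 / 2 * ((r ^ 2)⁻¹ * ((t + s) ⬝ᵥ R *ᵥ (t + s))) := by
  have hsymm : s ⬝ᵥ W *ᵥ t = t ⬝ᵥ W *ᵥ s := by
    rw [dotProduct_mulVec, ← mulVec_transpose, hW.eq, dotProduct_comm]
  have hG : G ⬝ᵥ (r⁻¹ • (t + s)) = (t + s) ⬝ᵥ W *ᵥ s := by
    rw [hs, dotProduct_smul, dotProduct_smul, dotProduct_comm]
  rw [hG]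
  simp only [add_mulVec, mulVec_smul, smul_mulVec, dotProduct_smul, smul_dotProduct,
    dotProduct_add, add_dotProduct, mulVec_add, smul_eq_mul, smul_add, hsymm]
  field_simp
  ring

/-- A Bernstein–von Mises limit along a filter on which all the assumptions hold eventually. -/
lemma tendsto_integral_abs_posterior_sub_gaussian [l.IsCountablyGenerated]
    {Θ : Set (Fin d → ℝ)} (hΘ : MeasurableSet Θ) {n : X → ℕ} (hn : Tendsto n l atTop)
    {ℓ : X → (Fin d → ℝ) → ℝ} {θs G : X → Fin d → ℝ}
    (hVsymm : ∀ x, (V x).IsSymm) (hVunit : ∀ x, IsUnit (V x).det)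
    {R : X → (Fin d → ℝ) → Matrix (Fin d) (Fin d) ℝ}
    (hexpand : ∀ x, ∀ θ ∈ Θ, ℓ x θ = ℓ x (θs x) + G x ⬝ᵥ (θ - θs x) -
      (1 / 2) * ((θ - θs x) ⬝ᵥ ((n x : ℝ) • V x + R x θ).mulVec (θ - θs x)))
    {π : (Fin d → ℝ) → ℝ} (hπnn : ∀ θ, 0 ≤ π θ) (hπint : Integrable π)
    {θ₀ : Fin d → ℝ} (hθ₀ : θ₀ ∈ interior Θ) (hθs : Tendsto θs l (nhds θ₀))
    (hV₀ : V₀.PosDef) (hV : Tendsto V l (nhds V₀))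
    {M : ℝ} (hG : ∀ᶠ x in l, ‖G x‖ ≤ M * √(n x))
    (hfar : ∀ δ > 0, ∃ ε > 0, ∀ᶠ x in l, ∀ θ ∈ Θ, δ ≤ ‖θ - θs x‖ →
      ℓ x θ - ℓ x (θs x) ≤ -(ε * n x))
    (hR : ∀ ε > 0, ∃ δ > 0, ∀ᶠ x in l, ∀ θ ∈ Θ, ‖θ - θs x‖ ≤ δ → ‖R x θ‖ ≤ ε * n x)
    (hπ : ContinuousAt π θ₀) (hπ₀ : 0 < π θ₀)
    (hint : ∀ᶠ x in l, IntegrableOn (fun θ => Real.exp (ℓ x θ) * π θ) Θ) :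
    Tendsto (fun x => ∫ t in {t : Fin d → ℝ |
          (θs x + (n x : ℝ)⁻¹ • (V x)⁻¹.mulVec (G x)) + (√(n x))⁻¹ • t ∈ Θ},
        |(π ((θs x + (n x : ℝ)⁻¹ • (V x)⁻¹.mulVec (G x)) + (√(n x))⁻¹ • t) *
            Real.exp (ℓ x ((θs x + (n x : ℝ)⁻¹ • (V x)⁻¹.mulVec (G x)) + (√(n x))⁻¹ • t))) /
          (∫ u in {u : Fin d → ℝ |
              (θs x + (n x : ℝ)⁻¹ • (V x)⁻¹.mulVec (G x)) + (√(n x))⁻¹ • u ∈ Θ},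
            π ((θs x + (n x : ℝ)⁻¹ • (V x)⁻¹.mulVec (G x)) + (√(n x))⁻¹ • u) *
              Real.exp (ℓ x ((θs x + (n x : ℝ)⁻¹ • (V x)⁻¹.mulVec (G x)) + (√(n x))⁻¹ • u))) -
          (2 * Real.pi) ^ (-(d : ℝ) / 2) * V₀.det ^ ((1 : ℝ) / 2) *
            Real.exp (-(1 / 2) * (t ⬝ᵥ V₀.mulVec t))|) l (nhds 0) := by
  set r : X → ℝ := fun x => √(n x) with hr_def
  have hr : Tendsto r l atTop :=
    Real.tendsto_sqrt_atTop.comp (tendsto_natCast_atTop_atTop.comp hn)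
  have hrn : ∀ x, r x ^ 2 = n x := fun x => Real.sq_sqrt (Nat.cast_nonneg _)
  set T : X → Fin d → ℝ := fun x => θs x + (n x : ℝ)⁻¹ • (V x)⁻¹ *ᵥ G x with hT_def
  set s : X → Fin d → ℝ := fun x => (V x)⁻¹ *ᵥ ((r x)⁻¹ • G x) with hs_def
  have hTs : ∀ x, T x = θs x + (r x)⁻¹ • s x := fun x => by
    have hinv : (r x)⁻¹ * (r x)⁻¹ = (n x : ℝ)⁻¹ := by rw [← mul_inv, ← sq, hrn]
    simp only [hT_def, hs_def, mulVec_smul, smul_smul, hinv]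
  have hVs : ∀ x, V x *ᵥ s x = (r x)⁻¹ • G x := fun x => by
    rw [hs_def, mulVec_mulVec, mul_nonsing_inv _ (hVunit x), one_mulVec]
  have hg : ∀ᶠ x in l, ‖(r x)⁻¹ • G x‖ ≤ M := by
    filter_upwards [hG, hr.eventually_gt_atTop 0] with x hx hrx
    rw [norm_smul, norm_inv, Real.norm_of_nonneg hrx.le, inv_mul_le_iff₀ hrx, mul_comm]
    exact hx
  obtain ⟨B, hB, hsB⟩ := eventually_dotProduct_self_inv_mulVec_le hV hV₀ hVunit hg
  have hT : Tendsto T l (nhds θ₀) := by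
    have hzero : Tendsto (fun x => (r x)⁻¹ • s x) l (nhds 0) := by
      refine squeeze_zero_norm' (a := fun x => (r x)⁻¹ * (1 + B)) ?_ ?_
      · filter_upwards [hsB, hr.eventually_gt_atTop 0] with x hx hrx
        rw [norm_smul, norm_inv, Real.norm_of_nonneg hrx.le]
        gcongr
        exact (norm_le_one_add_dotProduct_self _).trans (by gcongr; exact hx.1)
      · simpa using (tendsto_inv_atTop_zero.comp hr).mul_const (1 + B)
    have h := hθs.add hzero
    rw [add_zero] at h
    exact h.congr fun x => (hTs x).symm
  set a : X → ℝ := fun x => ℓ x (θs x) + 1 / 2 * (s x ⬝ᵥ V x *ᵥ s x) with ha_def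
  have hloc : ∀ δ > 0, ∀ᶠ x in l, ‖θs x - θ₀‖ ≤ δ := fun δ hδ => by
    filter_upwards [Metric.tendsto_nhds.mp hθs δ hδ] with x hx
    exact (dist_eq_norm (θs x) θ₀ ▸ hx).le
  have hquad : ∀ ε > 0, ∃ δ > 0, ∀ᶠ x in l, ∀ t, T x + (r x)⁻¹ • t ∈ Θ →
      ‖T x + (r x)⁻¹ • t - θ₀‖ ≤ δ →
      |(ℓ x (T x + (r x)⁻¹ • t) - a x) + 1 / 2 * (t ⬝ᵥ V₀ *ᵥ t)| ≤ ε * (1 + t ⬝ᵥ t) := by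
    intro ε hε
    obtain ⟨δ, hδ, hRδ⟩ := hR (ε / (2 * (d + 1) * (B + 1))) (by positivity)
    refine ⟨δ / 2, by positivity, ?_⟩
    filter_upwards [hRδ, hloc (δ / 2) (by positivity), hsB, hr.eventually_gt_atTop 0,
      eventually_abs_dotProduct_mulVec_sub_le hV hε] with x hRx hθx hsx hrx hVx t htΘ htδ
    set θ := T x + (r x)⁻¹ • t with hθ
    have hsub : θ - θs x = (r x)⁻¹ • (t + s x) := by
      rw [hθ, hTs, smul_add]
      abel
    have hRθ := hRx θ htΘ <| by
      calc ‖θ - θs x‖ ≤ ‖θ - θ₀‖ + ‖θs x - θ₀‖ := by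
            rw [← sub_sub_sub_cancel_right θ (θs x) θ₀]
            exact norm_sub_le _ _
        _ ≤ δ := by linarith
    have hexp : ℓ x θ - a x = -(1 / 2) * (t ⬝ᵥ V x *ᵥ t) -
        1 / 2 * ((r x ^ 2)⁻¹ * ((t + s x) ⬝ᵥ R x θ *ᵥ (t + s x))) := by
      have h := expansion_recentred (R := R x θ) (hVsymm x) hrx.ne' (hVs x) t
      rw [hexpand x θ htΘ, hsub, ← hrn]
      simp only [ha_def]
      linarith
    have hrem : (r x ^ 2)⁻¹ * |(t + s x) ⬝ᵥ R x θ *ᵥ (t + s x)| ≤ ε * (1 + t ⬝ᵥ t) := by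
      rw [inv_mul_le_iff₀ (by positivity)]
      refine (abs_dotProduct_mulVec_le
        (fun i j => (abs_apply_le_frobenius_norm _ i j).trans hRθ) _).trans ?_
      have hQt := dotProduct_self_nonneg_real t
      have hQ : (t + s x) ⬝ᵥ (t + s x) ≤ 2 * (B + 1) * (1 + t ⬝ᵥ t) := by
        have h1 := dotProduct_self_add_le t (s x)
        have h2 : s x ⬝ᵥ s x ≤ B := hsx.1
        nlinarith
      rw [← hrn]
      calc d * (ε / (2 * (d + 1) * (B + 1)) * r x ^ 2) * ((t + s x) ⬝ᵥ (t + s x))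
          ≤ (d + 1) * (ε / (2 * (d + 1) * (B + 1)) * r x ^ 2) *
              (2 * (B + 1) * (1 + t ⬝ᵥ t)) := by
            gcongr
            · exact dotProduct_self_nonneg_real _
            · linarith
        _ = r x ^ 2 * (ε * (1 + t ⬝ᵥ t)) := by
            field_simp
    have h1 := hVx t
    have hQt := dotProduct_self_nonneg_real t
    have h2 : (ℓ x θ - a x) + 1 / 2 * (t ⬝ᵥ V₀ *ᵥ t) =
        -(1 / 2 * (t ⬝ᵥ V x *ᵥ t - t ⬝ᵥ V₀ *ᵥ t) +
          1 / 2 * ((r x ^ 2)⁻¹ * ((t + s x) ⬝ᵥ R x θ *ᵥ (t + s x)))) := by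
      rw [hexp]; ring
    rw [h2, abs_neg]
    refine (abs_add_le _ _).trans ?_
    rw [abs_mul, abs_mul, abs_mul, abs_inv, abs_of_pos (show 0 < r x ^ 2 by positivity),
      abs_of_pos (show (0 : ℝ) < 1 / 2 by norm_num)]
    nlinarith
  have hfar' : ∀ δ > 0, ∃ ε > 0, ∀ᶠ x in l, ∀ θ ∈ Θ, δ ≤ ‖θ - θ₀‖ →
      ℓ x θ - a x ≤ -(ε * r x ^ 2) := by
    intro δ hδ
    obtain ⟨ε, hε, h⟩ := hfar (δ / 2) (by positivity)
    refine ⟨ε, hε, ?_⟩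
    filter_upwards [h, hloc (δ / 2) (by positivity), hsB] with x hx hθx hsx θ hθ hθδ
    have h1 := hx θ hθ <| by
      have : ‖θ - θ₀‖ ≤ ‖θ - θs x‖ + ‖θs x - θ₀‖ := norm_sub_le_norm_sub_add_norm_sub _ _ _
      linarith
    have h2 : 0 ≤ s x ⬝ᵥ V x *ᵥ s x := hsx.2
    rw [hrn]
    simp only [ha_def]
    linarith
  have hfactor : ∀ x θ, π θ * Real.exp (ℓ x θ - a x) =
      Real.exp (-a x) * (π θ * Real.exp (ℓ x θ)) := fun x θ => by
    rw [sub_eq_add_neg, Real.exp_add]; ring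
  have hint' : ∀ᶠ x in l, IntegrableOn (fun θ => π θ * Real.exp (ℓ x θ - a x)) Θ := by
    filter_upwards [hint] with x hx
    simp only [hfactor]
    simp only [mul_comm (Real.exp (ℓ x _))] at hx
    exact hx.const_mul _
  have hq := hV₀.integrable_exp.const_mul (π θ₀)
  have hqint : (∫ t : Fin d → ℝ, π θ₀ * Real.exp (-(1 / 2) * (t ⬝ᵥ V₀ *ᵥ t))) =
      π θ₀ * ((2 * Real.pi) ^ (-(d : ℝ) / 2) * V₀.det ^ ((1 : ℝ) / 2))⁻¹ := by
    rw [integral_const_mul, hV₀.integral_exp]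
  have hdet := hV₀.det_pos
  have hqpos : (∫ t : Fin d → ℝ, π θ₀ * Real.exp (-(1 / 2) * (t ⬝ᵥ V₀ *ᵥ t))) ≠ 0 := by
    rw [hqint]
    positivity
  have hfint : ∀ᶠ x in l, Integrable fun t =>
      Θ.indicator (fun θ => π θ * Real.exp (ℓ x θ - a x)) (T x + (r x)⁻¹ • t) := by
    filter_upwards [hint', hr.eventually_gt_atTop 0] with x hx hrx
    exact ((integrable_indicator_iff hΘ).mpr hx).comp_add_inv_smul (T x) hrx.ne'
  have hmain := tendsto_integral_abs_normalize_sub hq hqpos hfint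
    (tendsto_integral_abs_indicator_sub_gaussian hΘ hθ₀ hV₀ hπnn hπint hπ hr hT hquad hfar' hint')
  refine squeeze_zero' (.of_forall fun x => integral_nonneg fun t => abs_nonneg _) ?_ hmain
  filter_upwards [hfint] with x hx
  have hA : MeasurableSet {t : Fin d → ℝ | T x + (r x)⁻¹ • t ∈ Θ} :=
    (by fun_prop : Measurable fun t : Fin d → ℝ => T x + (r x)⁻¹ • t) hΘ
  have hind : (fun t => Θ.indicator (fun θ => π θ * Real.exp (ℓ x θ - a x))
      (T x + (r x)⁻¹ • t)) = {t : Fin d → ℝ | T x + (r x)⁻¹ • t ∈ Θ}.indicator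
        fun t => Real.exp (-a x) *
          (π (T x + (r x)⁻¹ • t) * Real.exp (ℓ x (T x + (r x)⁻¹ • t))) := by
    simp only [hfactor]
    rfl
  have hp : (fun t : Fin d → ℝ => (2 * Real.pi) ^ (-(d : ℝ) / 2) * V₀.det ^ ((1 : ℝ) / 2) *
      Real.exp (-(1 / 2) * (t ⬝ᵥ V₀ *ᵥ t))) = fun t =>
      π θ₀ * Real.exp (-(1 / 2) * (t ⬝ᵥ V₀ *ᵥ t)) /
        ∫ t : Fin d → ℝ, π θ₀ * Real.exp (-(1 / 2) * (t ⬝ᵥ V₀ *ᵥ t)) := by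
    funext t
    rw [hqint]
    field_simp
  rw [hind] at hx
  have hle := setIntegral_abs_normalize_sub_le hA (Real.exp_ne_zero (-a x)) hx (hq.div_const
    (∫ t : Fin d → ℝ, π θ₀ * Real.exp (-(1 / 2) * (t ⬝ᵥ V₀ *ᵥ t))))
  rw [← hind] at hle
  refine le_trans (le_of_eq ?_) hle
  simp only [← congrFun hp]
  rfl

end DeterministicLimit

section InProbability

variable {Ω : Type*} [MeasurableSpace Ω]

/-- The filter on `ℕ × Ω` of the sets whose sections over `N` have complements of (outer)
`P`-measure tending to `0`. -/
def inProbability (P : Measure Ω) : Filter (ℕ × Ω) where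
  sets := {S | Tendsto (fun N => P {ω | (N, ω) ∉ S}) atTop (nhds 0)}
  univ_sets := by simp
  sets_of_superset := fun {S S'} hS hSS' =>
    tendsto_of_tendsto_of_tendsto_of_le_of_le tendsto_const_nhds hS (fun _ => zero_le)
      fun N => measure_mono fun ω hω hωS => hω (hSS' hωS)
  inter_sets := fun {S S'} hS hS' => by
    have hadd := Tendsto.add hS hS'
    rw [add_zero] at hadd
    refine tendsto_of_tendsto_of_tendsto_of_le_of_le tendsto_const_nhds hadd (fun _ => zero_le)
      fun N => (measure_mono fun ω hω => ?_).trans (measure_union_le _ _)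
    exact not_and_or.mp hω

variable {P : Measure Ω}

lemma eventually_inProbability {p : ℕ × Ω → Prop} :
    (∀ᶠ x in inProbability P, p x) ↔ Tendsto (fun N => P {ω | ¬ p (N, ω)}) atTop (nhds 0) :=
  Iff.rfl

lemma tendsto_fst_inProbability : Tendsto Prod.fst (inProbability P) atTop := by
  refine tendsto_atTop.mpr fun N => eventually_inProbability.mpr ?_
  refine tendsto_const_nhds.congr' ?_
  filter_upwards [eventually_ge_atTop N] with n hn
  simp [hn]

lemma eventually_inProbability_of_tendsto_one [IsProbabilityMeasure P] {p : ℕ × Ω → Prop}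
    (hmeas : ∀ N, MeasurableSet {ω | p (N, ω)})
    (hp : Tendsto (fun N => P {ω | p (N, ω)}) atTop (nhds 1)) :
    ∀ᶠ x in inProbability P, p x := by
  have h := ENNReal.Tendsto.sub (tendsto_const_nhds (x := (1 : ENNReal)) (f := atTop)) hp
    (Or.inl ENNReal.one_ne_top)
  rw [tsub_self] at h
  exact h.congr fun N => (prob_compl_eq_one_sub (hmeas N)).symm

/-- If a property holds in probability along every event on which `g` is bounded, and `g` is
bounded in probability, then it holds in probability. -/
lemma eventually_inProbability_of_bounded [IsProbabilityMeasure P] {p : ℕ × Ω → Prop}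
    {b : ℝ → ℕ × Ω → Prop}
    (hb : ∀ η : ℝ, 0 < η → ∃ M : ℝ,
      limsup (fun N : ℕ => (P {ω | ¬ b M (N, ω)}).toReal) atTop < η)
    (hp : ∀ M : ℝ, ∀ᶠ x in inProbability P, b M x → p x) :
    ∀ᶠ x in inProbability P, p x := by
  refine eventually_inProbability.mpr (ENNReal.tendsto_nhds_zero.mpr fun η hη => ?_)
  set η' := min (η / 2) 1 with hη'
  have hη'top : η' ≠ ⊤ := ne_top_of_le_ne_top ENNReal.one_ne_top (min_le_right _ _)
  have hη'pos : 0 < η' := lt_min (ENNReal.half_pos hη.ne') one_pos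
  obtain ⟨M, hM⟩ := hb η'.toReal (ENNReal.toReal_pos hη'pos.ne' hη'top)
  have hbM := eventually_lt_of_limsup_lt hM
    (isBoundedUnder_of ⟨1, fun N => by
      simpa using ENNReal.toReal_mono ENNReal.one_ne_top prob_le_one⟩)
  filter_upwards [hbM, ENNReal.tendsto_nhds_zero.mp (eventually_inProbability.mp (hp M)) η' hη'pos]
    with N h1 h2
  have h1' := (ENNReal.toReal_lt_toReal (measure_ne_top P _) hη'top).mp h1
  calc P {ω | ¬ p (N, ω)}
      ≤ P ({ω | ¬ b M (N, ω)} ∪ {ω | ¬ (b M (N, ω) → p (N, ω))}) := by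
        refine measure_mono fun ω (hω : ¬ p (N, ω)) => ?_
        by_cases hbω : b M (N, ω)
        · exact Or.inr fun h => hω (h hbω)
        · exact Or.inl hbω
    _ ≤ η' + η' := (measure_union_le _ _).trans (add_le_add h1'.le h2)
    _ ≤ η / 2 + η / 2 := add_le_add (min_le_left _ _) (min_le_left _ _)
    _ = η := ENNReal.add_halves η

lemma measurableSet_forall_le_of_continuousOn {E : Type*} [PseudoMetricSpace E]
    [TopologicalSpace.SeparableSpace E] {S : Set E} {f : Ω → E → ℝ}
    (hmeas : ∀ θ, Measurable fun ω => f ω θ) (hcont : ∀ ω, ContinuousOn (f ω) S) (c : ℝ) :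
    MeasurableSet {ω | ∀ θ ∈ S, f ω θ ≤ c} := by
  obtain ⟨D, hDS, hD, hSD⟩ :=
    (TopologicalSpace.IsSeparable.of_separableSpace S).exists_countable_dense_subset
  have heq : {ω | ∀ θ ∈ S, f ω θ ≤ c} = ⋂ θ ∈ D, {ω | f ω θ ≤ c} := by
    ext ω
    simp only [Set.mem_ofPred_eq, Set.mem_iInter]
    refine ⟨fun h θ hθ => h θ (hDS hθ), fun h θ hθ => ?_⟩
    exact ContinuousWithinAt.closure_le (hSD hθ) ((hcont ω θ hθ).mono hDS)
      continuousWithinAt_const h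
  rw [heq]
  exact MeasurableSet.biInter hD fun θ _ => measurableSet_le (hmeas θ) measurable_const

end InProbability

/-- misspecified Bernstein–von Mises theorem, total-variation form.
Under Assumptions (A1)–(A6), the random variables
`D_N = ∫_{√N(Θ−T_N)} |π_N(t|·) − φ_{0,(V*)⁻¹}(t)| dt` converge to `0` in `P`-probability as
`N → ∞`, where `T_N = θ*_N + N⁻¹ V_N⁻¹ G_N`, `π_N(·|ω)` is the Lebesgue density of
`√N(ϑ − T_N)` for `ϑ` drawn from the posterior with density proportional to
`exp(ℓ_N(ω,·)) π`, and `φ_{0,(V*)⁻¹}(t) = (2π)^{−d/2} det(V*)^{1/2} e^{−½ tᵀ V* t}` is the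
normal density with mean `0` and covariance matrix `(V*)⁻¹`. -/
theorem stmt0 {d : ℕ} {Ω : Type*} [MeasurableSpace Ω] (P : Measure Ω) [IsProbabilityMeasure P]
    (Θ : Set (Fin d → ℝ)) (hΘmeas : MeasurableSet Θ)
    -- misspecified log-likelihoods, measurable in ω, continuous in θ
    (ℓ : ℕ → Ω → (Fin d → ℝ) → ℝ)
    (hℓmeas : ∀ N θ, Measurable fun ω => ℓ N ω θ)
    (hℓcont : ∀ N ω, ContinuousOn (ℓ N ω) Θ)
    -- the points θ*_N, the scores G_N, the matrices V_N and the remainders R_N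
    (θs : ℕ → Fin d → ℝ) (hθsΘ : ∀ N, θs N ∈ Θ)
    (G : ℕ → Ω → Fin d → ℝ) (hGmeas : ∀ N, Measurable (G N))
    (V : ℕ → Matrix (Fin d) (Fin d) ℝ)
    (hVsymm : ∀ N, (V N).IsSymm) (hVunit : ∀ N, IsUnit (V N).det)
    (R : ℕ → Ω → (Fin d → ℝ) → Matrix (Fin d) (Fin d) ℝ)
    (hRsymm : ∀ N ω θ, (R N ω θ).IsSymm)
    (hRmeas : ∀ N θ i j, Measurable fun ω => R N ω θ i j)
    -- the exact second-order expansion of ℓ_N around θ*_N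
    (hexpand : ∀ N ω, ∀ θ ∈ Θ,
      ℓ N ω θ = ℓ N ω (θs N) + G N ω ⬝ᵥ (θ - θs N) -
        (1 / 2) * ((θ - θs N) ⬝ᵥ ((N : ℝ) • V N + R N ω θ).mulVec (θ - θs N)))
    -- the prior density π
    (π : (Fin d → ℝ) → ℝ) (hπnn : ∀ θ, 0 ≤ π θ) (hπmeas : Measurable π)
    (hπdens : ∫ θ, π θ = 1)
    -- (A1)
    (θlim : Fin d → ℝ) (hθlim : θlim ∈ interior Θ)
    (hA1 : Tendsto θs atTop (nhds θlim))
    -- (A2)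
    (Vlim : Matrix (Fin d) (Fin d) ℝ) (hVlimSymm : Vlim.IsSymm) (hVlimPD : Vlim.PosDef)
    (hA2 : Tendsto V atTop (nhds Vlim))
    -- (A3): N^{-1/2} G_N is bounded in P-probability
    (hA3 : ∀ η : ℝ, 0 < η → ∃ M : ℝ,
      limsup (fun N : ℕ => (P {ω | M * Real.sqrt N < ‖G N ω‖}).toReal) atTop < η)
    -- (A4)
    (hA4 : ∀ δ : ℝ, 0 < δ → ∃ ε : ℝ, 0 < ε ∧
      Tendsto (fun N : ℕ => P {ω | ∀ θ ∈ Θ, δ ≤ ‖θ - θs N‖ →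
        ℓ N ω θ - ℓ N ω (θs N) ≤ -(ε * N)}) atTop (nhds 1))
    -- (A5)
    (hA5 : ∀ ε : ℝ, 0 < ε → ∃ δ : ℝ, 0 < δ ∧
      Tendsto (fun N : ℕ => P {ω | ∃ θ ∈ Θ, ‖θ - θs N‖ ≤ δ ∧ ε * N ≤ ‖R N ω θ‖})
        atTop (nhds 0))
    -- (A6)
    (hA6cont : ContinuousAt π θlim) (hA6pos : 0 < π θlim)
    -- the posterior is a.s. well defined: 0 < ∫_Θ exp(ℓ_N(ω,θ)) π(θ) dθ < ∞
    (hposterior : ∀ N : ℕ, ∀ᵐ ω ∂P,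
      IntegrableOn (fun θ => Real.exp (ℓ N ω θ) * π θ) Θ volume ∧
      0 < ∫ θ in Θ, Real.exp (ℓ N ω θ) * π θ) :
    ∀ ε : ℝ, 0 < ε →
      Tendsto (fun N : ℕ => P {ω | ε <
        ∫ t in {t : Fin d → ℝ |
            (θs N + (N : ℝ)⁻¹ • (V N)⁻¹.mulVec (G N ω)) + (Real.sqrt N)⁻¹ • t ∈ Θ},
          |(π ((θs N + (N : ℝ)⁻¹ • (V N)⁻¹.mulVec (G N ω)) + (Real.sqrt N)⁻¹ • t) *
              Real.exp (ℓ N ω ((θs N + (N : ℝ)⁻¹ • (V N)⁻¹.mulVec (G N ω)) +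
                (Real.sqrt N)⁻¹ • t))) /
            (∫ u in {u : Fin d → ℝ |
                (θs N + (N : ℝ)⁻¹ • (V N)⁻¹.mulVec (G N ω)) + (Real.sqrt N)⁻¹ • u ∈ Θ},
              π ((θs N + (N : ℝ)⁻¹ • (V N)⁻¹.mulVec (G N ω)) + (Real.sqrt N)⁻¹ • u) *
                Real.exp (ℓ N ω ((θs N + (N : ℝ)⁻¹ • (V N)⁻¹.mulVec (G N ω)) +
                  (Real.sqrt N)⁻¹ • u))) -
            (2 * Real.pi) ^ (-(d : ℝ) / 2) * Vlim.det ^ ((1 : ℝ) / 2) *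
              Real.exp (-(1 / 2) * (t ⬝ᵥ Vlim.mulVec t))|})
        atTop (nhds 0) := by
  intro ε hε
  have hπint : Integrable π := by
    by_contra h
    simp [integral_undef h] at hπdens
  choose εfar hεfar hfarP using fun j : ℕ => hA4 (1 / ((j : ℝ) + 1)) (by positivity)
  choose δR hδR hRP using fun j : ℕ => hA5 (1 / ((j : ℝ) + 1)) (by positivity)
  -- the countably many events on which the pathwise limit depends
  set far : ℕ → ℕ × Ω → Prop := fun j x => ∀ θ ∈ Θ, 1 / ((j : ℝ) + 1) ≤ ‖θ - θs x.1‖ →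
    ℓ x.1 x.2 θ - ℓ x.1 x.2 (θs x.1) ≤ -(εfar j * x.1) with hfar_def
  set rem : ℕ → ℕ × Ω → Prop := fun j x => ∀ θ ∈ Θ, ‖θ - θs x.1‖ ≤ δR j →
    ‖R x.1 x.2 θ‖ ≤ 1 / ((j : ℝ) + 1) * x.1 with hrem_def
  set post : ℕ × Ω → Prop := fun x =>
    IntegrableOn (fun θ => Real.exp (ℓ x.1 x.2 θ) * π θ) Θ with hpost_def
  set l : Filter (ℕ × Ω) := comap Prod.fst atTop ⊓ (⨅ j, 𝓟 {x | far j x}) ⊓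
    (⨅ j, 𝓟 {x | rem j x}) ⊓ 𝓟 {x | post x} with hl_def
  have hl : inProbability P ≤ l := by
    refine le_inf (le_inf (le_inf tendsto_fst_inProbability.le_comap (le_iInf fun j => ?_))
      (le_iInf fun j => ?_)) ?_ <;> rw [le_principal_iff]
    · refine eventually_inProbability_of_tendsto_one (p := far j) (fun N => ?_) (hfarP j)
      have hm := measurableSet_forall_le_of_continuousOn
        (S := {θ | θ ∈ Θ ∧ 1 / ((j : ℝ) + 1) ≤ ‖θ - θs N‖})
        (f := fun ω θ => ℓ N ω θ - ℓ N ω (θs N))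
        (fun θ => (hℓmeas N θ).sub (hℓmeas N (θs N)))
        (fun ω => ((hℓcont N ω).mono fun θ hθ => hθ.1).sub continuousOn_const) (-(εfar j * N))
      simpa only [Set.mem_ofPred_eq, and_imp] using hm
    · refine tendsto_of_tendsto_of_tendsto_of_le_of_le tendsto_const_nhds (hRP j)
        (fun _ => zero_le) fun N => measure_mono fun ω (hω : ¬ rem j (N, ω)) => ?_
      simp only [hrem_def, not_forall, not_le] at hω
      obtain ⟨θ, hθ, hθδ, hlt⟩ := hω
      exact ⟨θ, hθ, hθδ, hlt.le⟩
    · refine tendsto_const_nhds.congr fun N => Eq.symm ?_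
      exact ae_iff.mp ((hposterior N).mono fun ω hω => hω.1)
  have hlfst : Tendsto Prod.fst l atTop :=
    tendsto_comap.mono_left (inf_le_left.trans (inf_le_left.trans inf_le_left))
  have hlfar : ∀ j, ∀ᶠ x in l, far j x := fun j => by
    have h : l ≤ 𝓟 {x | far j x} := inf_le_left.trans (inf_le_left.trans
      (inf_le_right.trans (iInf_le (fun j => 𝓟 {x | far j x}) j)))
    exact h (mem_principal_self _)
  have hlrem : ∀ j, ∀ᶠ x in l, rem j x := fun j => by
    have h : l ≤ 𝓟 {x | rem j x} := inf_le_left.trans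
      (inf_le_right.trans (iInf_le (fun j => 𝓟 {x | rem j x}) j))
    exact h (mem_principal_self _)
  have hlpost : ∀ᶠ x in l, post x := by
    have h : l ≤ 𝓟 {x | post x} := inf_le_right
    exact h (mem_principal_self _)
  have key := eventually_inProbability_of_bounded (P := P)
    (b := fun M x => ‖G x.1 x.2‖ ≤ M * √(x.1 : ℝ)) (p := fun x => ¬ (ε <
        ∫ t in {t : Fin d → ℝ |
            (θs x.1 + (x.1 : ℝ)⁻¹ • (V x.1)⁻¹.mulVec (G x.1 x.2)) + (Real.sqrt x.1)⁻¹ • t ∈ Θ},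
          |(π ((θs x.1 + (x.1 : ℝ)⁻¹ • (V x.1)⁻¹.mulVec (G x.1 x.2)) + (Real.sqrt x.1)⁻¹ • t) *
              Real.exp (ℓ x.1 x.2 ((θs x.1 + (x.1 : ℝ)⁻¹ • (V x.1)⁻¹.mulVec (G x.1 x.2)) +
                (Real.sqrt x.1)⁻¹ • t))) /
            (∫ u in {u : Fin d → ℝ |
                (θs x.1 + (x.1 : ℝ)⁻¹ • (V x.1)⁻¹.mulVec (G x.1 x.2)) +
                  (Real.sqrt x.1)⁻¹ • u ∈ Θ},
              π ((θs x.1 + (x.1 : ℝ)⁻¹ • (V x.1)⁻¹.mulVec (G x.1 x.2)) +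
                (Real.sqrt x.1)⁻¹ • u) *
                Real.exp (ℓ x.1 x.2 ((θs x.1 + (x.1 : ℝ)⁻¹ • (V x.1)⁻¹.mulVec (G x.1 x.2)) +
                  (Real.sqrt x.1)⁻¹ • u))) -
            (2 * Real.pi) ^ (-(d : ℝ) / 2) * Vlim.det ^ ((1 : ℝ) / 2) *
              Real.exp (-(1 / 2) * (t ⬝ᵥ Vlim.mulVec t))|))
    (by simpa only [not_le] using hA3) ?_
  · simpa only [not_not] using eventually_inProbability.mp key
  intro M
  refine hl (eventually_inf_principal.mp ?_)
  have hle : l ⊓ 𝓟 {x | ‖G x.1 x.2‖ ≤ M * √(x.1 : ℝ)} ≤ l := inf_le_left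
  have hlim := tendsto_integral_abs_posterior_sub_gaussian
    (l := l ⊓ 𝓟 {x | ‖G x.1 x.2‖ ≤ M * √(x.1 : ℝ)}) hΘmeas (n := Prod.fst)
    (hlfst.mono_left hle) (ℓ := fun x => ℓ x.1 x.2) (θs := fun x => θs x.1)
    (G := fun x => G x.1 x.2) (V := fun x => V x.1) (fun x => hVsymm x.1) (fun x => hVunit x.1)
    (R := fun x => R x.1 x.2) (fun x => hexpand x.1 x.2) hπnn hπint hθlim
    (hA1.comp (hlfst.mono_left hle)) hVlimPD (hA2.comp (hlfst.mono_left hle)) (M := M)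
    (mem_inf_of_right (mem_principal_self _))
    (fun δ hδ => by
      obtain ⟨j, hj⟩ := exists_nat_one_div_lt hδ
      refine ⟨εfar j, hεfar j, ?_⟩
      filter_upwards [hle (hlfar j)] with x hx θ hθ hθδ
      exact hx θ hθ (hj.le.trans hθδ))
    (fun η hη => by
      obtain ⟨j, hj⟩ := exists_nat_one_div_lt hη
      refine ⟨δR j, hδR j, ?_⟩
      filter_upwards [hle (hlrem j)] with x hx θ hθ hθδ
      exact (hx θ hθ hθδ).trans (by gcongr))
    hA6cont hA6pos (hle hlpost)
  filter_upwards [hlim.eventually (Iic_mem_nhds hε)] with x hx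
  exact not_lt.mpr hx
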